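/- Let a > b be natural numbers, let m ≥ 1, and let x, y : ℕ → ℕ be sequences with x 1 = a, y 1 = b, and for every i with 1 ≤ i < m: y i ≥ 1, x (i+1) = y i, and y (i+1) = x i % y i. Define the potential s i = x i + y i. Then for every i with 2 ≤ i ≤ m, 3 * s i ≤ 2 * s (i-1). -/

import Mathlib

theorem three_mul_add_mod_le_two_mul_add {x y : ℕ} (hy : 1 ≤ y) (hxy : y < x) :
    3 * (y + x % y) ≤ 2 * (x + y) := by
  have hmod : x % y < y := Nat.mod_lt x hy
  have hle : x % y + y ≤ x := by
    rw [Nat.mod_eq_sub_mod hxy.le]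
    have := Nat.mod_le (x - y) y
    omega
  omega

theorem euclid_potential_step_seq (a b m : ℕ) (hab : a > b) (hm : 1 ≤ m)
    (x y : ℕ → ℕ) (hx1 : x 1 = a) (hy1 : y 1 = b)
    (hstep : ∀ i, 1 ≤ i → i < m → 1 ≤ y i ∧ x (i + 1) = y i ∧ y (i + 1) = x i % y i)
    (s : ℕ → ℕ) (hs : ∀ i, s i = x i + y i) :
    ∀ i, 2 ≤ i → i ≤ m → 3 * s i ≤ 2 * s (i - 1) := by
  have hlt : ∀ i, 1 ≤ i → i ≤ m → y i < x i := by
    intro i hi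
    induction i, hi using Nat.le_induction with
    | base => intro _; rwa [hx1, hy1]
    | succ i hi _ =>
      intro him
      obtain ⟨hy, hx', hy'⟩ := hstep i hi him
      rw [hx', hy']
      exact Nat.mod_lt _ hy
  intro i hi him
  obtain ⟨j, rfl⟩ : ∃ j, i = j + 1 := ⟨i - 1, by omega⟩
  obtain ⟨hy, hx', hy'⟩ := hstep j (by omega) him
  rw [Nat.add_sub_cancel, hs, hs, hx', hy']
  exact three_mul_add_mod_le_two_mul_add hy (hlt j (by omega) (by omega))
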